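/- Let H be a Hilbert space and ξ a random variable with values in H such that ‖ξ‖_H ≤ M almost surely. Let ξ_1,…,ξ_N be a sample of N independent observations of ξ. Then for any 0 < δ < 1, with probability at least 1−δ, ‖(1/N) Σ_{i=1}^N (ξ_i − 𝔼ξ)‖_H ≤ 2M log(2/δ)/N + √(2𝔼(‖ξ‖_H²) log(2/δ)/N). -/

import Mathlib

set_option synthInstance.maxHeartbeats 1000000
set_option maxHeartbeats 1000000

open MeasureTheory ENNReal

noncomputable section

lemma cosh_chord (y p q θ : ℝ) (h0 : 0 ≤ θ) (h1 : θ ≤ 1)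
    (h : y ^ 2 = (1 - θ) * p ^ 2 + θ * q ^ 2) :
    Real.cosh y ≤ (1 - θ) * Real.cosh p + θ * Real.cosh q := by
  have hy := Real.hasSum_cosh y
  have hp := (Real.hasSum_cosh p).mul_left (1 - θ)
  have hq := (Real.hasSum_cosh q).mul_left θ
  refine hasSum_le (fun n => ?_) hy (hp.add hq)
  have := (convexOn_pow (𝕜 := ℝ) n).2 (x := p ^ 2) (Set.mem_Ici.2 (sq_nonneg p)) (y := q ^ 2)
    (Set.mem_Ici.2 (sq_nonneg q)) (sub_nonneg.2 h1) h0 (by ring)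
  simp only [smul_eq_mul] at this
  rw [← h] at this
  simp only [pow_mul]
  rw [← mul_div_assoc, ← mul_div_assoc, ← add_div]
  gcongr

lemma cosh_norm_add_le {H : Type*} [NormedAddCommGroup H] [InnerProductSpace ℝ H] (x v : H) :
    Real.cosh ‖x + v‖ ≤ Real.cosh ‖x‖ + (Real.sinh ‖x‖ / ‖x‖) * inner ℝ x v
      + Real.cosh ‖x‖ * (Real.exp ‖v‖ - 1 - ‖v‖) := by
  have key : ∀ a b c : ℝ, 0 ≤ a → 0 ≤ b → -1 ≤ c → c ≤ 1 → 
      ‖x + v‖ ^ 2 = a ^ 2 + 2 * (a * b * c) + b ^ 2 →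
      Real.cosh ‖x + v‖ ≤ Real.cosh a + Real.sinh a * b * c
        + Real.cosh a * (Real.exp b - 1 - b) := by
    intro a b c ha hb hc1 hc2 h
    have h1 := cosh_chord ‖x + v‖ (a - b) (a + b) ((1 + c) / 2) (by linarith) (by linarith)
      (by rw [h]; ring)
    rw [Real.cosh_add, Real.cosh_sub] at h1
    rw [← Real.cosh_add_sinh b]
    have h2 : b ≤ Real.sinh b := Real.self_le_sinh_iff.2 hb
    have h3 : Real.sinh a ≤ Real.cosh a := (Real.sinh_lt_cosh a).le
    have h4 : 0 ≤ Real.sinh a := Real.sinh_nonneg_iff.2 ha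
    have h5 : Real.sinh a * c ≤ Real.cosh a := by nlinarith
    nlinarith [mul_le_mul_of_nonneg_right h5 (sub_nonneg.2 h2)]
  have hn := norm_add_sq_real x v
  by_cases hx : ‖x‖ = 0
  · have := key ‖x‖ ‖v‖ 0 (norm_nonneg _) (norm_nonneg _) (by norm_num) (by norm_num)
      (by rw [hn, norm_eq_zero.1 hx]; simp)
    simpa [hx] using this
  by_cases hv : ‖v‖ = 0
  · simp [norm_eq_zero.1 hv]
  have hab : 0 < ‖x‖ * ‖v‖ := by positivity
  have hi := abs_le.1 (abs_real_inner_le_norm x v)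
  have := key ‖x‖ ‖v‖ (inner ℝ x v / (‖x‖ * ‖v‖)) (norm_nonneg _) (norm_nonneg _)
    (by rw [le_div_iff₀ hab]; linarith) (by rw [div_le_iff₀ hab]; linarith)
    (by rw [hn]; field_simp)
  convert this using 3
  field_simp

lemma exp_bern {b u : ℝ} (hb : 0 ≤ b) (hu : b ≤ 2 * u) (h1 : u < 1) :
    Real.exp b - 1 - b ≤ (1 / (2 * (1 - u))) * b ^ 2 := by
  have hb2 : b < 2 := by linarith
  have h : b ≤ Real.log ((2 + b) / (2 - b)) := by
    have hs := Real.hasSum_log_sub_log_of_abs_lt_one (x := b / 2)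
      (by rw [abs_of_nonneg (by linarith)]; linarith)
    have := le_hasSum hs 0 (fun j _ => by positivity)
    rw [Real.log_div (by linarith) (by linarith)]
    have e1 : Real.log (2 + b) = Real.log 2 + Real.log (1 + b / 2) := by
      rw [← Real.log_mul (by norm_num) (by linarith)]; congr 1; ring
    have e2 : Real.log (2 - b) = Real.log 2 + Real.log (1 - b / 2) := by
      rw [← Real.log_mul (by norm_num) (by linarith)]; congr 1; ring
    rw [e1, e2]
    norm_num at this
    linarith
  have h2 : Real.exp b ≤ (2 + b) / (2 - b) :=
    (Real.le_log_iff_exp_le (div_pos (by linarith) (by linarith))).1 h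
  have h3 : Real.exp b - 1 - b ≤ b ^ 2 / (2 - b) := by
    have : (2 + b) / (2 - b) - 1 - b = b ^ 2 / (2 - b) := by
      have : 2 - b ≠ 0 := by linarith
      field_simp; ring
    linarith
  refine h3.trans ?_
  rw [one_div_mul_eq_div]
  exact div_le_div_of_nonneg_left (sq_nonneg b) (by linarith) (by linarith)

lemma pinelis_step {H : Type*} [NormedAddCommGroup H] [InnerProductSpace ℝ H] [CompleteSpace H]
    {Ω : Type*} [MeasurableSpace Ω] (P : Measure Ω) [IsProbabilityMeasure P]
    (f : Ω → H) (hf : AEStronglyMeasurable f P) (u c K : ℝ) (hu : ∀ᵐ ω ∂P, ‖f ω‖ ≤ u)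
    (hc : ∀ᵐ ω ∂P, Real.exp ‖f ω‖ - 1 - ‖f ω‖ ≤ c * ‖f ω‖ ^ 2)
    (h0 : ∫ ω, f ω ∂P = 0) (hK : c * ∫ ω, ‖f ω‖ ^ 2 ∂P ≤ K) (x : H) :
    ∫⁻ ω, ENNReal.ofReal (Real.cosh ‖x + f ω‖) ∂P
      ≤ ENNReal.ofReal (Real.cosh ‖x‖) * ENNReal.ofReal (1 + K) := by
  have hfi : Integrable f P := Integrable.of_bound hf u hu
  have hf2 : Integrable (fun ω => ‖f ω‖ ^ 2) P := by
    refine Integrable.of_bound (hf.norm.pow 2) (u ^ 2) ?_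
    filter_upwards [hu] with ω h
    rw [Real.norm_of_nonneg (by positivity)]
    gcongr
  have hin : Integrable (fun ω => inner ℝ x (f ω)) P := hfi.const_inner x
  set g : Ω → ℝ := fun ω => Real.cosh ‖x‖ + (Real.sinh ‖x‖ / ‖x‖) * inner ℝ x (f ω)
      + Real.cosh ‖x‖ * (c * ‖f ω‖ ^ 2) with hg
  have hle : ∀ᵐ ω ∂P, Real.cosh ‖x + f ω‖ ≤ g ω := by
    filter_upwards [hc] with ω h
    refine (cosh_norm_add_le x (f ω)).trans ?_
    simp only [hg]
    gcongr
  have hi1 : Integrable (fun ω => Real.cosh ‖x‖ + (Real.sinh ‖x‖ / ‖x‖) * inner ℝ x (f ω)) P :=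
    (integrable_const _).add (hin.const_mul _)
  have hi2 : Integrable (fun ω => Real.cosh ‖x‖ * (c * ‖f ω‖ ^ 2)) P :=
    (hf2.const_mul _).const_mul _
  have hgi : Integrable g P := hi1.add hi2
  have hint : ∫ ω, g ω ∂P = Real.cosh ‖x‖ * (1 + c * ∫ ω, ‖f ω‖ ^ 2 ∂P) := by
    simp only [hg]
    rw [integral_add hi1 hi2, integral_add (integrable_const _) (hin.const_mul _),
      integral_const_mul, integral_inner hfi, h0, integral_const_mul, integral_const_mul]
    simp
    ring
  calc ∫⁻ ω, ENNReal.ofReal (Real.cosh ‖x + f ω‖) ∂P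
      ≤ ∫⁻ ω, ENNReal.ofReal (g ω) ∂P :=
        lintegral_mono_ae (hle.mono fun ω h => ENNReal.ofReal_le_ofReal h)
    _ = ENNReal.ofReal (∫ ω, g ω ∂P) := by
        rw [ofReal_integral_eq_lintegral_ofReal hgi]
        exact hle.mono fun ω h => (Real.cosh_pos _).le.trans h
    _ ≤ _ := by
        rw [hint, ← ENNReal.ofReal_mul (Real.cosh_pos _).le]
        apply ENNReal.ofReal_le_ofReal
        have := (Real.cosh_pos ‖x‖).le
        gcongr

lemma pinelis_iter {H : Type*} [NormedAddCommGroup H]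
    {Ω : Type*} [MeasurableSpace Ω] (P : Measure Ω) [IsProbabilityMeasure P]
    (f : Ω → H) (hf : AEStronglyMeasurable f P) (C : ℝ≥0∞)
    (h : ∀ x : H, ∫⁻ ω, ENNReal.ofReal (Real.cosh ‖x + f ω‖) ∂P
      ≤ ENNReal.ofReal (Real.cosh ‖x‖) * C) (n : ℕ) : ∀ x : H,
    ∫⁻ w, ENNReal.ofReal (Real.cosh ‖x + ∑ i, f (w i)‖) ∂(Measure.pi fun _ : Fin n => P)
      ≤ ENNReal.ofReal (Real.cosh ‖x‖) * C ^ n := by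
  induction n with
  | zero => intro x; simp
  | succ n ih =>
    intro x
    have hmp := (measurePreserving_piFinSuccAbove (fun _ : Fin (n + 1) => P) 0)
    have e : ∀ w : Fin (n + 1) → Ω, ENNReal.ofReal (Real.cosh ‖x + ∑ i, f (w i)‖) =
      (fun z : Ω × (Fin n → Ω) => ENNReal.ofReal (Real.cosh ‖x + f z.1 + ∑ i, f (z.2 i)‖))
        (MeasurableEquiv.piFinSuccAbove (fun _ => Ω) 0 w) := by
      intro w
      simp [Fin.sum_univ_succ, add_assoc, MeasurableEquiv.piFinSuccAbove, Fin.tail]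
    have e2 := hmp.lintegral_comp_emb (MeasurableEquiv.measurableEmbedding _)
      (fun z : Ω × (Fin n → Ω) => ENNReal.ofReal (Real.cosh ‖x + f z.1 + ∑ i, f (z.2 i)‖))
    refine ((lintegral_congr e).trans e2).le.trans ?_
    refine (lintegral_prod_le _).trans ?_
    calc _ ≤ ∫⁻ ω, ENNReal.ofReal (Real.cosh ‖x + f ω‖) * C ^ n ∂P :=
          lintegral_mono fun ω => ih (x + f ω)
      _ = (∫⁻ ω, ENNReal.ofReal (Real.cosh ‖x + f ω‖) ∂P) * C ^ n := by
          refine lintegral_mul_const'' _ ?_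
          exact ((Real.continuous_cosh.measurable.comp_aemeasurable
            (hf.const_add x).norm.aemeasurable)).ennreal_ofReal
      _ ≤ _ := by
          rw [pow_succ', ← mul_assoc]
          gcongr
          exact h x

lemma integral_centered_sq_le {H : Type*} [NormedAddCommGroup H] [InnerProductSpace ℝ H]
    [CompleteSpace H]
    {Ω : Type*} [MeasurableSpace Ω] (P : Measure Ω) [IsProbabilityMeasure P]
    (f : Ω → H) (hf : Integrable f P) (hf2 : Integrable (fun ω => ‖f ω‖ ^ 2) P) :
    ∫ ω, ‖f ω - ∫ ω', f ω' ∂P‖ ^ 2 ∂P ≤ ∫ ω, ‖f ω‖ ^ 2 ∂P := by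
  set m := ∫ ω', f ω' ∂P with hm
  have e : ∀ ω, ‖f ω - m‖ ^ 2 = ‖f ω‖ ^ 2 - 2 * inner ℝ m (f ω) + ‖m‖ ^ 2 := by
    intro ω
    rw [norm_sub_sq_real, real_inner_comm]
  have hin : Integrable (fun ω => 2 * inner ℝ m (f ω)) P := (hf.const_inner m).const_mul 2
  have h1 : Integrable (fun ω => ‖f ω‖ ^ 2 - 2 * inner ℝ m (f ω)) P := hf2.sub hin
  simp_rw [e]
  rw [integral_add h1 (integrable_const _), integral_sub hf2 hin, integral_const_mul,
    integral_inner hf, ← hm, real_inner_self_eq_norm_sq]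
  simp
  nlinarith [sq_nonneg ‖m‖]

lemma pinelis_tail {H : Type*} [NormedAddCommGroup H] [InnerProductSpace ℝ H] [CompleteSpace H]
    {Ω : Type*} [MeasurableSpace Ω] (P : Measure Ω) [IsProbabilityMeasure P]
    (N : ℕ) (M : ℝ) (hM : 0 ≤ M) (ξ : Ω → H)
    (hmeas : AEStronglyMeasurable ξ P) (hbound : ∀ᵐ ω ∂P, ‖ξ ω‖ ≤ M)
    (l : ℝ) (hl : 0 < l) (hlM : l * M < 1) (r : ℝ) :
    (Measure.pi fun _ : Fin N => P)
      {w : Fin N → Ω | r < ‖∑ i, (ξ (w i) - ∫ ω, ξ ω ∂P)‖} ≤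
    ENNReal.ofReal (2 * Real.exp
      (N * (1 / (2 * (1 - l * M)) * (l ^ 2 * ∫ ω, ‖ξ ω‖ ^ 2 ∂P)) - l * r)) := by
  set m := ∫ ω, ξ ω ∂P with hm
  set V := ∫ ω, ‖ξ ω‖ ^ 2 ∂P with hV
  have hV0 : 0 ≤ V := integral_nonneg fun ω => by positivity
  have hξi : Integrable ξ P := Integrable.of_bound hmeas M hbound
  have hξ2 : Integrable (fun ω => ‖ξ ω‖ ^ 2) P := by
    refine Integrable.of_bound (hmeas.norm.pow 2) (M ^ 2) ?_
    filter_upwards [hbound] with ω h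
    rw [Real.norm_of_nonneg (by positivity)]
    gcongr
  have hmM : ‖m‖ ≤ M := by
    have := norm_integral_le_of_norm_le_const hbound
    simpa using this
  set f : Ω → H := fun ω => l • (ξ ω - m) with hf
  have hfm : AEStronglyMeasurable f P := (hmeas.sub aestronglyMeasurable_const).const_smul l
  have hfu : ∀ᵐ ω ∂P, ‖f ω‖ ≤ 2 * (l * M) := by
    filter_upwards [hbound] with ω h
    simp only [hf, norm_smul, Real.norm_of_nonneg hl.le]
    have : ‖ξ ω - m‖ ≤ M + M := (norm_sub_le _ _).trans (by gcongr)
    nlinarith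
  have hc : ∀ᵐ ω ∂P, Real.exp ‖f ω‖ - 1 - ‖f ω‖ ≤ 1 / (2 * (1 - l * M)) * ‖f ω‖ ^ 2 := by
    filter_upwards [hfu] with ω h
    exact exp_bern (norm_nonneg _) h hlM
  have h0 : ∫ ω, f ω ∂P = 0 := by
    simp only [hf]
    rw [integral_smul, integral_sub hξi (integrable_const _)]
    simp [hm]
  have hc0 : 0 ≤ 1 / (2 * (1 - l * M)) := by
    have : 0 < 1 - l * M := by linarith
    positivity
  set K := 1 / (2 * (1 - l * M)) * (l ^ 2 * V) with hKdef
  have hK0 : 0 ≤ K := by positivity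
  have hK : 1 / (2 * (1 - l * M)) * ∫ ω, ‖f ω‖ ^ 2 ∂P ≤ K := by
    simp only [hf, norm_smul, Real.norm_of_nonneg hl.le, mul_pow]
    rw [integral_const_mul, hKdef]
    gcongr
    exact integral_centered_sq_le P ξ hξi hξ2
  have hit := pinelis_iter P f hfm _
    (pinelis_step P f hfm _ _ K hfu hc h0 hK) N 0
  have hsum : ∀ w : Fin N → Ω, ‖(0 : H) + ∑ i, f (w i)‖ = l * ‖∑ i, (ξ (w i) - m)‖ := by
    intro w
    simp only [hf]
    rw [zero_add, ← Finset.smul_sum, norm_smul, Real.norm_of_nonneg hl.le]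
  have hae : AEMeasurable (fun w : Fin N → Ω =>
      ENNReal.ofReal (Real.cosh ‖(0 : H) + ∑ i, f (w i)‖)) (Measure.pi fun _ : Fin N => P) := by
    have hS : AEStronglyMeasurable (fun w : Fin N → Ω => (0 : H) + ∑ i, f (w i))
        (Measure.pi fun _ : Fin N => P) := by
      refine AEStronglyMeasurable.const_add ?_ 0
      refine Finset.aestronglyMeasurable_fun_sum _ fun i _ => ?_
      exact hfm.comp_quasiMeasurePreserving
        (Measure.quasiMeasurePreserving_eval (fun _ : Fin N => P) i)
    exact (Real.continuous_cosh.measurable.comp_aemeasurable hS.norm.aemeasurable).ennreal_ofReal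
  have hmk := meas_ge_le_lintegral_div hae (ε := ENNReal.ofReal (Real.exp (l * r) / 2))
    (by simpa using Real.exp_pos _) ENNReal.ofReal_ne_top
  refine (measure_mono ?_).trans (hmk.trans ?_)
  · intro w hw
    simp only [Set.mem_setOf_eq] at hw ⊢
    apply ENNReal.ofReal_le_ofReal
    rw [hsum, Real.cosh_eq]
    have h1 : Real.exp (l * r) ≤ Real.exp (l * ‖∑ i, (ξ (w i) - m)‖) := by gcongr
    have h2 := Real.exp_pos (-(l * ‖∑ i, (ξ (w i) - m)‖))
    linarith
  · have hC : ∫⁻ w, ENNReal.ofReal (Real.cosh ‖(0 : H) + ∑ i, f (w i)‖)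
        ∂(Measure.pi fun _ : Fin N => P) ≤ ENNReal.ofReal (Real.exp (N * K)) := by
      refine hit.trans ?_
      rw [norm_zero, Real.cosh_zero, ENNReal.ofReal_one, one_mul,
        ← ENNReal.ofReal_pow (by linarith), Real.exp_nat_mul]
      apply ENNReal.ofReal_le_ofReal
      have : 1 + K ≤ Real.exp K := by linarith [Real.add_one_le_exp K]
      gcongr
    refine (ENNReal.div_le_div_right hC _).trans ?_
    rw [← ENNReal.ofReal_div_of_pos (by positivity)]
    apply ENNReal.ofReal_le_ofReal
    rw [Real.exp_sub]
    apply le_of_eq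
    field_simp

/-- **Lemma 2.8 (Pinelis).**  Let `H` be a Hilbert space and `ξ` an `H`-valued random
variable with `‖ξ‖_H ≤ M` almost surely.  Let `ξ_1, …, ξ_N` be `N` independent
observations of `ξ` (modelled by the coordinates of the product measure `P^N`).  Then for
any `0 < δ < 1`, with probability at least `1 − δ`,
`‖(1/N) ∑_{i=1}^N (ξ_i − 𝔼ξ)‖_H ≤ 2M log(2/δ)/N + √(2 𝔼‖ξ‖² log(2/δ)/N)`. -/
theorem pinelis_concentration
    (H : Type*) [NormedAddCommGroup H] [InnerProductSpace ℝ H] [CompleteSpace H]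
    (Ω : Type*) [MeasurableSpace Ω] (P : Measure Ω) [IsProbabilityMeasure P]
    (N : ℕ) (M : ℝ)
    (ξ : Ω → H)
    (hmeas : AEStronglyMeasurable ξ P)
    (hbound : ∀ᵐ ω ∂P, ‖ξ ω‖ ≤ M) :
    ∀ δ : ℝ, 0 < δ → δ < 1 →
      ENNReal.ofReal (1 - δ) ≤
        (Measure.pi fun _ : Fin N => P)
          {w : Fin N → Ω |
            ‖(N : ℝ)⁻¹ • ∑ i, (ξ (w i) - ∫ ω, ξ ω ∂P)‖ ≤
              2 * M * Real.log (2 / δ) / N +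
                Real.sqrt (2 * (∫ ω, ‖ξ ω‖ ^ 2 ∂P) * Real.log (2 / δ) / N)} := by
  intro δ hδ0 hδ1
  have hM : 0 ≤ M := by
    obtain ⟨ω, h⟩ := hbound.exists
    exact (norm_nonneg _).trans h
  set V := ∫ ω, ‖ξ ω‖ ^ 2 ∂P with hV
  have hV0 : 0 ≤ V := integral_nonneg fun ω => by positivity
  set t := Real.log (2 / δ) with ht
  have ht0 : 0 < t := Real.log_pos (by rw [lt_div_iff₀ hδ0]; linarith)
  have hξ2 : Integrable (fun ω => ‖ξ ω‖ ^ 2) P := by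
    refine Integrable.of_bound (hmeas.norm.pow 2) (M ^ 2) ?_
    filter_upwards [hbound] with ω h
    rw [Real.norm_of_nonneg (by positivity)]
    gcongr
  have hone : ENNReal.ofReal (1 - δ) ≤ 1 := by
    rw [← ENNReal.ofReal_one]; exact ENNReal.ofReal_le_ofReal (by linarith)
  rcases Nat.eq_zero_or_pos N with hN | hN
  · subst hN
    simpa using by linarith
  have hNR : (0 : ℝ) < N := by exact_mod_cast hN
  rcases hV0.eq_or_lt with hVz | hVp
  · -- degenerate case
    have hz : ∀ᵐ ω ∂P, ξ ω = 0 := by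
      have := (integral_eq_zero_iff_of_nonneg (fun ω => by positivity) hξ2).1 (hV ▸ hVz.symm)
      filter_upwards [this] with ω h
      simpa using h
    have hm : ∫ ω, ξ ω ∂P = 0 := integral_eq_zero_of_ae hz
    have hall : ∀ᵐ w ∂(Measure.pi fun _ : Fin N => P), ∀ i, ξ (w i) = 0 :=
      ae_all_iff.2 fun i =>
        (Measure.quasiMeasurePreserving_eval (fun _ : Fin N => P) i).ae hz
    refine hone.trans ?_
    rw [← measure_univ (μ := Measure.pi fun _ : Fin N => P)]
    refine measure_mono_ae ?_
    filter_upwards [hall] with w hw _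
    show ‖_‖ ≤ _
    simp only [hw, hm, sub_zero, Finset.sum_const_zero, smul_zero, norm_zero]
    positivity
  set B := Real.sqrt (N * V) with hB
  have hBp : 0 < B := Real.sqrt_pos.2 (by positivity)
  have hB2 : B ^ 2 = N * V := Real.sq_sqrt (by positivity)
  set q := Real.sqrt (2 * t) with hq
  have hqp : 0 < q := Real.sqrt_pos.2 (by positivity)
  have hq2 : q ^ 2 = 2 * t := Real.sq_sqrt (by positivity)
  have hD : 0 < B + M * q := by positivity
  set l := q / (B + M * q) with hl
  have hlp : 0 < l := by positivity
  have hlM1 : 1 - l * M = B / (B + M * q) := by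
    rw [hl]; field_simp; ring
  have hlM : l * M < 1 := by
    have : 0 < B / (B + M * q) := by positivity
    linarith
  have hs : Real.sqrt (2 * V * t / N) = q * B / N := by
    rw [Real.sqrt_eq_iff_mul_self_eq (by positivity) (by positivity)]
    have : q * B / N * (q * B / N) = q ^ 2 * B ^ 2 / N ^ 2 := by ring
    rw [this, hq2, hB2]
    field_simp
  have htail := pinelis_tail P N M hM ξ hmeas hbound l hlp hlM (M * q ^ 2 + q * B)
  have hexp : 2 * Real.exp (N * (1 / (2 * (1 - l * M)) * (l ^ 2 * V)) - l * (M * q ^ 2 + q * B))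
      ≤ δ := by
    have e1 : N * (1 / (2 * (1 - l * M)) * (l ^ 2 * V)) = q ^ 2 / 2 * (B / (B + M * q)) := by
      have : N * (1 / (2 * (1 - l * M)) * (l ^ 2 * V))
        = 1 / (2 * (1 - l * M)) * (l ^ 2 * (N * V)) := by ring
      rw [this, ← hB2, hlM1, hl]
      field_simp
    have e2 : l * (M * q ^ 2 + q * B) = q ^ 2 := by
      rw [hl]; field_simp; ring
    have e3 : B / (B + M * q) ≤ 1 := by
      rw [div_le_one hD]
      have : 0 ≤ M * q := by positivity
      linarith
    have e4 : q ^ 2 / 2 * (B / (B + M * q)) - q ^ 2 ≤ -t := by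
      rw [hq2]; nlinarith
    rw [e1, e2]
    calc _ ≤ 2 * Real.exp (-t) := by gcongr
      _ = δ := by
        rw [Real.exp_neg, ht, Real.exp_log (by positivity)]
        field_simp
  set S := {w : Fin N → Ω |
            ‖(N : ℝ)⁻¹ • ∑ i, (ξ (w i) - ∫ ω, ξ ω ∂P)‖ ≤
              2 * M * t / N + Real.sqrt (2 * V * t / N)} with hS
  have hcompl : (Measure.pi fun _ : Fin N => P) Sᶜ ≤ ENNReal.ofReal δ := by
    refine (measure_mono ?_).trans (htail.trans (ENNReal.ofReal_le_ofReal hexp))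
    intro w hw
    simp only [hS, Set.mem_compl_iff, Set.mem_setOf_eq, not_le] at hw ⊢
    rw [hs, norm_smul, norm_inv, Real.norm_of_nonneg hNR.le, ← add_div, ← div_eq_inv_mul,
      div_lt_div_iff_of_pos_right hNR] at hw
    rw [hq2]
    linarith
  have huniv : (1 : ℝ≥0∞) ≤ (Measure.pi fun _ : Fin N => P) S
      + (Measure.pi fun _ : Fin N => P) Sᶜ := by
    rw [← measure_univ (μ := Measure.pi fun _ : Fin N => P), ← Set.union_compl_self S]
    exact measure_union_le _ _
  rw [ENNReal.ofReal_sub _ hδ0.le, ENNReal.ofReal_one, tsub_le_iff_right]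
  exact huniv.trans (by gcongr)
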